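/- Let X be a connected uniformly locally finite graph with ℤ₂-large circuits, i.e., for every R there is a circuit of X that is not the sum of a locally finite family of circuits of length ≤ R (equivalently, 𝒞_R(X,ℤ₂) ≠ 𝒞(X,ℤ₂) for every R). Then the ℤ₂-vector space Z^suf_1(X,ℤ₂)/𝒞_∞(X,ℤ₂) is infinite dimensional: for every n there exist f_1, …, f_n ∈ Z^suf_1(X,ℤ₂) whose classes modulo 𝒞_∞(X,ℤ₂) are linearly independent over ℤ₂. In particular H^uf_1(X,ℤ₂) is infinite dimensional. -/

import Mathlib

open scoped Classical

namespace UFH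

variable {V : Type}

/-- Uniform local finiteness: a uniform bound on vertex degrees. -/
def ULF (G : SimpleGraph V) : Prop :=
  ∃ D : ℕ, ∀ v : V, (G.neighborSet v).Finite ∧ (G.neighborSet v).ncard ≤ D

/-- An integer 1-chain: antisymmetric and supported on adjacent pairs. -/
def IsChain1 (G : SimpleGraph V) (f : V → V → ℤ) : Prop :=
  (∀ u v, f u v = - f v u) ∧ ∀ u v, f u v ≠ 0 → G.Adj u v

/-- A mod-2 1-chain: symmetric and supported on adjacent pairs. -/
def IsChain1Z2 (G : SimpleGraph V) (f : V → V → ZMod 2) : Prop :=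
  (∀ u v, f u v = f v u) ∧ ∀ u v, f u v ≠ 0 → G.Adj u v

/-- Divergence of an integer 1-chain at a vertex. -/
noncomputable def chainDiv (f : V → V → ℤ) (v : V) : ℤ := ∑ᶠ u, f u v

/-- Divergence of a mod-2 1-chain at a vertex. -/
noncomputable def chainDivZ2 (f : V → V → ZMod 2) (v : V) : ZMod 2 := ∑ᶠ u, f u v

def Bdd (f : V → V → ℤ) (C : ℕ) : Prop := ∀ u v, |f u v| ≤ (C : ℤ)

/-- The sup-norm of a bounded integer 1-chain (least uniform bound). -/
noncomputable def chainNorm (f : V → V → ℤ) : ℕ := sInf {C : ℕ | Bdd f C}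

/-- Bounded integer flows: bounded 1-chains with vanishing divergence everywhere. -/
def Zsuf1 (G : SimpleGraph V) : Set (V → V → ℤ) :=
  {f | IsChain1 G f ∧ (∃ C, Bdd f C) ∧ ∀ v, chainDiv f v = 0}

/-- Mod-2 cycles: mod-2 1-chains whose support meets every vertex evenly. -/
def Zsuf1Z2 (G : SimpleGraph V) : Set (V → V → ZMod 2) :=
  {f | IsChain1Z2 G f ∧ ∀ v, chainDivZ2 f v = 0}

/-- A circuit: a closed walk (based at some vertex). -/
abbrev Circuit (G : SimpleGraph V) := Σ v : V, G.Walk v v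

/-- Number of traversals of the oriented edge `(a, b)` by the walk `p`. -/
noncomputable def traversals {G : SimpleGraph V} {u v : V} (p : G.Walk u v) (a b : V) : ℕ :=
  ((Finset.range p.length).filter fun i => p.getVert i = a ∧ p.getVert (i + 1) = b).card

/-- The integer 1-chain of signed traversals of a walk. -/
noncomputable def walkChain {G : SimpleGraph V} {u v : V} (p : G.Walk u v) (a b : V) : ℤ :=
  (traversals p a b : ℤ) - (traversals p b a : ℤ)

/-- The mod-2 1-chain of traversals of a walk. -/
noncomputable def walkChainZ2 {G : SimpleGraph V} {u v : V} (p : G.Walk u v) (a b : V) : ZMod 2 :=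
  (traversals p a b : ZMod 2) + (traversals p b a : ZMod 2)

/-- The walk `p` passes through the edge `{a, b}`. -/
def OnWalk {G : SimpleGraph V} {u v : V} (p : G.Walk u v) (a b : V) : Prop :=
  ∃ i < p.length, (p.getVert i = a ∧ p.getVert (i + 1) = b) ∨
    (p.getVert i = b ∧ p.getVert (i + 1) = a)

/-- A coefficient family on circuits is thin (locally finite). -/
def ThinCoef (G : SimpleGraph V) (g : Circuit G → ℤ) : Prop :=
  ∀ a b : V, {c : Circuit G | g c ≠ 0 ∧ OnWalk c.2 a b}.Finite

def ThinCoefZ2 (G : SimpleGraph V) (g : Circuit G → ZMod 2) : Prop :=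
  ∀ a b : V, {c : Circuit G | g c ≠ 0 ∧ OnWalk c.2 a b}.Finite

/-- The 1-chain obtained as the (pointwise) sum of a family of circuits with coefficients. -/
noncomputable def circSum (G : SimpleGraph V) (g : Circuit G → ℤ) : V → V → ℤ :=
  fun a b => ∑ᶠ c : Circuit G, g c * walkChain c.2 a b

noncomputable def circSumZ2 (G : SimpleGraph V) (g : Circuit G → ZMod 2) : V → V → ZMod 2 :=
  fun a b => ∑ᶠ c : Circuit G, g c * walkChainZ2 c.2 a b

/-- 𝒞_r(X, ℤ): sums of circuits of length ≤ r with uniformly bounded integer coefficients. -/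
def Cr (G : SimpleGraph V) (r : ℕ) : Set (V → V → ℤ) :=
  {f | ∃ g : Circuit G → ℤ, (∃ C : ℕ, ∀ c, |g c| ≤ (C : ℤ)) ∧
    (∀ c, g c ≠ 0 → c.2.length ≤ r) ∧ ThinCoef G g ∧ f = circSum G g}

/-- 𝒞_∞(X, ℤ). -/
def Cinf (G : SimpleGraph V) : Set (V → V → ℤ) := ⋃ r : ℕ, Cr G r

/-- 𝒞(X, ℤ): thin sums of circuits with integer coefficients whose result is bounded. -/
def Cthin (G : SimpleGraph V) : Set (V → V → ℤ) :=
  {f | ∃ g : Circuit G → ℤ, ThinCoef G g ∧ (∃ C, Bdd f C) ∧ f = circSum G g}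

/-- 𝒞_r(X, ℤ₂). -/
def CrZ2 (G : SimpleGraph V) (r : ℕ) : Set (V → V → ZMod 2) :=
  {f | ∃ g : Circuit G → ZMod 2, (∀ c, g c ≠ 0 → c.2.length ≤ r) ∧
    ThinCoefZ2 G g ∧ f = circSumZ2 G g}

/-- 𝒞_∞(X, ℤ₂). -/
def CinfZ2 (G : SimpleGraph V) : Set (V → V → ZMod 2) := ⋃ r : ℕ, CrZ2 G r

/-- 𝒞(X, ℤ₂): thin sums of circuits mod 2. -/
def CthinZ2 (G : SimpleGraph V) : Set (V → V → ZMod 2) :=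
  {f | ∃ g : Circuit G → ZMod 2, ThinCoefZ2 G g ∧ f = circSumZ2 G g}

/-- `a` and `b` are joined by a walk avoiding the set `K`. -/
def ConnAvoiding (G : SimpleGraph V) (K : Set V) (a b : V) : Prop :=
  ∃ p : G.Walk a b, ∀ v ∈ p.support, v ∉ K

/-- A (one-sided infinite) ray in `G`. -/
def IsRay (G : SimpleGraph V) (x : ℕ → V) : Prop :=
  Function.Injective x ∧ ∀ n, G.Adj (x n) (x (n + 1))

/-- Two rays determine the same end. -/
def RayEquiv (G : SimpleGraph V) (x y : ℕ → V) : Prop :=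
  ∀ K : Finset V, ∃ N, ∀ n, N ≤ n → ∀ m, N ≤ m → ConnAvoiding G (↑K) (x n) (y m)

/-- The connected component of `v` in `X − K`. -/
def Component (G : SimpleGraph V) (K : Set V) (v : V) : Set V :=
  {u | u ∉ K ∧ ConnAvoiding G K u v}

def MoreThanOneEnd (G : SimpleGraph V) : Prop :=
  ∃ K : Finset V, ∃ v w : V, v ∉ K ∧ w ∉ K ∧ (Component G (↑K) v).Infinite ∧
    (Component G (↑K) w).Infinite ∧ ¬ ConnAvoiding G (↑K) v w

def OneEnded (G : SimpleGraph V) : Prop :=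
  Infinite V ∧ ∀ K : Finset V, ∃ v, v ∉ K ∧ (Component G (↑K) v).Infinite ∧
    ∀ u, u ∉ K → (Component G (↑K) u).Infinite → ConnAvoiding G (↑K) u v

/-- A bip: a bi-infinite path, i.e. injective graph morphism ℤ → T. -/
def IsBip (T : SimpleGraph V) (b : ℤ → V) : Prop :=
  Function.Injective b ∧ ∀ n : ℤ, T.Adj (b n) (b (n + 1))

/-- The bip `b` lies over the edge `{u, v}`. -/
def LiesOver (b : ℤ → V) (u v : V) : Prop :=
  ∃ n : ℤ, (b n = u ∧ b (n + 1) = v) ∨ (b n = v ∧ b (n + 1) = u)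

/-- The signed traversal of the oriented edge `(u, v)` by the bip `b`. -/
noncomputable def bipSign (b : ℤ → V) (u v : V) : ℤ :=
  if ∃ n : ℤ, b n = u ∧ b (n + 1) = v then 1
  else if ∃ n : ℤ, b n = v ∧ b (n + 1) = u then -1 else 0

noncomputable def bipOverZ2 (b : ℤ → V) (u v : V) : ZMod 2 :=
  if LiesOver b u v then 1 else 0

/-- `p` is the last bip of `P` (w.r.t. the order `r`) lying over the edge `{u, v}`. -/
def IsLast (P : Set (ℤ → V)) (r : (ℤ → V) → (ℤ → V) → Prop) (p : ℤ → V) (u v : V) : Prop :=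
  LiesOver p u v ∧ ∀ q ∈ P, q ≠ p → LiesOver q u v → r q p

/-- The 1-chain associated to coefficients on a family of bips. -/
noncomputable def bipMap (P : Set (ℤ → V)) (f : ↥P → ℤ) : V → V → ℤ :=
  fun u v => ∑ᶠ p : ↥P, f p * bipSign p.1 u v

noncomputable def bipMapZ2 (P : Set (ℤ → V)) (f : ↥P → ZMod 2) : V → V → ZMod 2 :=
  fun u v => ∑ᶠ p : ↥P, f p * bipOverZ2 p.1 u v

/-- The set `S` is connected in the graph `H` (walks staying inside `S`). -/
def ConnectedIn (H : SimpleGraph V) (S : Set V) : Prop :=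
  ∀ a ∈ S, ∀ b ∈ S, ∃ p : H.Walk a b, ∀ v ∈ p.support, v ∈ S

/-- `T` is a subtree of `G`. -/
def IsSubtree (G T : SimpleGraph V) : Prop :=
  T ≤ G ∧ T.IsAcyclic ∧ T.support.Nonempty ∧ ConnectedIn T T.support

/-- Every vertex of `T` has degree ≥ 2 in `T`. -/
def Leafless (T : SimpleGraph V) : Prop :=
  ∀ v ∈ T.support, ∃ u w : V, u ≠ w ∧ T.Adj v u ∧ T.Adj v w

/-- Distinct ends of `T` determine distinct ends of `G`. -/
def EndRespecting (G T : SimpleGraph V) : Prop :=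
  ∀ x y : ℕ → V, IsRay T x → IsRay T y → RayEquiv G x y → RayEquiv T x y

/-- Every end of `G` is represented by a unique end of `T`. -/
def EndDefining (G T : SimpleGraph V) : Prop :=
  EndRespecting G T ∧ ∀ x : ℕ → V, IsRay G x → ∃ y : ℕ → V, IsRay T y ∧ RayEquiv G x y

/-- The subtree `T` of `G` has separators. -/
def HasSeparators (G T : SimpleGraph V) : Prop :=
  ∃ K : ℕ → Finset V,
    (∀ n, K n ⊆ K (n + 1)) ∧
    (∀ v : V, ∃ n, v ∈ K n) ∧
    (∀ n, ConnectedIn G (↑(K n))) ∧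
    (∀ n, ConnectedIn T (T.support ∩ ↑(K n))) ∧
    (∀ n, ∀ v : V, v ∉ K n → (Component G (↑(K n)) v).Infinite →
      ∃! e : V × V, T.Adj e.1 e.2 ∧ e.1 ∈ K n ∧ e.2 ∉ K n ∧
        e.2 ∈ Component G (↑(K n)) v) ∧
    (∀ n, ∀ a b : V, T.Adj a b → a ∈ K n → b ∉ K n → (Component G (↑(K n)) b).Infinite)

/-- An integer 2-chain: alternating, supported on triangles. -/
def IsChain2 (G : SimpleGraph V) (g : V → V → V → ℤ) : Prop :=
  (∀ u v w, g u v w = - g v u w) ∧ (∀ u v w, g u v w = - g u w v) ∧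
    ∀ u v w, g u v w ≠ 0 → G.Adj u v ∧ G.Adj v w ∧ G.Adj u w

def Bdd2 (g : V → V → V → ℤ) (C : ℕ) : Prop := ∀ u v w, |g u v w| ≤ (C : ℤ)

/-- The boundary of a 2-chain. -/
noncomputable def bd2 (g : V → V → V → ℤ) : V → V → ℤ := fun u v => ∑ᶠ w, g u v w

/-- `H^suf_1`-expansion. -/
def HsufExp1 (G : SimpleGraph V) : Prop :=
  ∃ K : ℕ → ℕ, ∀ U : Finset V, ∀ f : V → V → ℤ,
    IsChain1 G f →
    (∀ u v, f u v ≠ 0 → u ∈ U ∧ v ∈ U) →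
    (∀ v ∈ U, (∀ u, G.Adj u v → u ∈ U) → chainDiv f v = 0) →
    (∃ fh ∈ Zsuf1 G, (∀ u ∈ U, ∀ v ∈ U, fh u v = f u v) ∧ chainNorm fh = chainNorm f) →
    ∃ g : V → V → V → ℤ, IsChain2 G g ∧ Bdd2 g (K (chainNorm f)) ∧
      ∀ u ∈ U, ∀ v ∈ U, bd2 g u v = f u v

/-- Pure `H^suf_1`-expansion. -/
def PureHsufExp1 (G : SimpleGraph V) : Prop :=
  ∃ K : ℕ → ℕ, ∀ U : Finset V, ∀ f : V → V → ℤ,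
    IsChain1 G f →
    (∀ u v, f u v ≠ 0 → u ∈ U ∧ v ∈ U) →
    (∀ v ∈ U, (∀ u, G.Adj u v → u ∈ U) → chainDiv f v = 0) →
    (∃ fh : V → V → ℤ, IsChain1 G fh ∧
        (∃ g2 : V → V → V → ℤ, IsChain2 G g2 ∧ (∃ C, Bdd2 g2 C) ∧ bd2 g2 = fh) ∧
        (∀ u ∈ U, ∀ v ∈ U, fh u v = f u v) ∧ chainNorm fh = chainNorm f) →
    ∃ g : V → V → V → ℤ, IsChain2 G g ∧ Bdd2 g (K (chainNorm f)) ∧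
      ∀ u ∈ U, ∀ v ∈ U, bd2 g u v = f u v

/-- The Rips graph of radius `s`. -/
def rips (G : SimpleGraph V) (s : ℕ) : SimpleGraph V :=
  SimpleGraph.fromRel fun u v => G.dist u v ≤ s

/-- Pure `H^uf_1`-expansion: the Rips graphs eventually have pure `H^suf_1`-expansion. -/
def PureHufExp1 (G : SimpleGraph V) : Prop := ∃ s₀ : ℕ, ∀ s, s₀ ≤ s → PureHsufExp1 (rips G s)

def VertexTransitive (G : SimpleGraph V) : Prop := ∀ u v : V, ∃ φ : G ≃g G, φ u = v

/-- The edge boundary of a finite set of vertices. -/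
def edgeBoundary (G : SimpleGraph V) (U : Finset V) : Set (Sym2 V) :=
  {e | e ∈ G.edgeSet ∧ ∃ a b : V, e = s(a, b) ∧ a ∈ U ∧ b ∉ U}

/-- Mod-2 reduction of an integer 1-chain. -/
def mod2 (f : V → V → ℤ) : V → V → ZMod 2 := fun u v => ((f u v : ℤ) : ZMod 2)

/-- Pointwise domination of 1-chains: `r` flows in the same direction as `φ`, no stronger. -/
def chainLE (r φ : V → V → ℤ) : Prop :=
  ∀ u v, (0 ≤ φ u v → 0 ≤ r u v ∧ r u v ≤ φ u v) ∧ (φ u v ≤ 0 → φ u v ≤ r u v ∧ r u v ≤ 0)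

/-- A set of functions is locally finite (thin). -/
def ThinFamily {Y : Type} (F : Set (Y → ZMod 2)) : Prop := ∀ y : Y, {f ∈ F | f y ≠ 0}.Finite

/-- The pointwise sum of a (thin) set of functions. -/
noncomputable def thinSum {Y : Type} (F : Set (Y → ZMod 2)) : Y → ZMod 2 :=
  fun y => ∑ᶠ f : ↥F, f.1 y

/-- A thin-sum space: a subspace closed under thin sums. -/
def IsThinSumSpace {Y : Type} (W : Set (Y → ZMod 2)) : Prop :=
  0 ∈ W ∧ (∀ f ∈ W, ∀ g ∈ W, f + g ∈ W) ∧ ∀ F ⊆ W, ThinFamily F → thinSum F ∈ W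

/-- A thin-sum basis for a thin-sum space. -/
def IsThinSumBasis {Y : Type} (A W : Set (Y → ZMod 2)) : Prop :=
  A ⊆ W ∧ (∀ f ∈ W, ∃ F ⊆ A, ThinFamily F ∧ f = thinSum F) ∧
    ∀ F ⊆ A, ThinFamily F → F.Nonempty → thinSum F ≠ 0

section CompactModules

/-- In a compact vector space over `ZMod 2`, a finite-codimensional increasing union of closed
subspaces has a member of finite index (by the Baire category theorem). -/
theorem exists_finite_quotient_of_finite_quotient_iUnion {M : Type*} [AddCommGroup M]
    [Module (ZMod 2) M] [TopologicalSpace M] [IsTopologicalAddGroup M] [CompactSpace M] [T2Space M]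
    (H : ℕ → Submodule (ZMod 2) M) (K : Submodule (ZMod 2) M)
    (hclosed : ∀ R, IsClosed (H R : Set M)) (hK : ∀ x ∈ K, ∃ R, x ∈ H R) [Finite (M ⧸ K)] :
    ∃ R, Finite (M ⧸ (H R).toAddSubgroup) := by
  let coset : ℕ × (M ⧸ K) → Set M := fun p => {x | x - p.2.out ∈ H p.1}
  have hcl : ∀ p, IsClosed (coset p) := fun p =>
    (hclosed p.1).preimage (continuous_id.sub continuous_const)
  have hcover : ⋃ p, coset p = Set.univ := by
    refine Set.eq_univ_of_forall fun x => ?_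
    have hx : x - (Submodule.Quotient.mk x : M ⧸ K).out ∈ K := by
      rw [← Submodule.Quotient.eq]
      exact (Quotient.out_eq _).symm
    obtain ⟨R, hR⟩ := hK _ hx
    exact Set.mem_iUnion.2 ⟨(R, Submodule.Quotient.mk x), hR⟩
  obtain ⟨⟨R, q⟩, y, hy⟩ := nonempty_interior_of_iUnion_of_closed hcl hcover
  refine ⟨R, AddSubgroup.quotient_finite_of_isOpen _ ?_⟩
  refine AddSubgroup.isOpen_of_mem_nhds (g := y - q.out) _ ?_
  have h : Filter.Tendsto (fun x => x + q.out) (nhds (y - q.out)) (nhds y) := by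
    simpa using (continuous_add_const q.out).tendsto (y - q.out)
  filter_upwards [h (mem_interior_iff_mem_nhds.1 hy)] with x hx
  simpa [coset] using hx

theorem exists_linearIndependent_fin_of_infinite {M : Type*} [AddCommGroup M] [Module (ZMod 2) M]
    [Infinite M] (n : ℕ) : ∃ f : Fin n → M, LinearIndependent (ZMod 2) f := by
  refine exists_linearIndependent_of_le_rank ?_
  by_contra h
  have : Module.Finite (ZMod 2) M :=
    Module.rank_lt_aleph0_iff.1 ((not_le.1 h).trans (Cardinal.natCast_lt_aleph0))
  exact not_finite_iff_infinite.2 ‹_› (Module.finite_of_finite (ZMod 2))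

end CompactModules

section Walks

variable {G : SimpleGraph V}

theorem onWalk_of_traversals_ne_zero {u v : V} {p : G.Walk u v} {a b : V}
    (h : traversals p a b ≠ 0) : OnWalk p a b := by
  obtain ⟨i, hi⟩ := Finset.card_pos.1 (Nat.pos_of_ne_zero h)
  simp only [Finset.mem_filter, Finset.mem_range] at hi
  exact ⟨i, hi.1, Or.inl hi.2⟩

theorem OnWalk.symm {u v : V} {p : G.Walk u v} {a b : V} (h : OnWalk p a b) : OnWalk p b a := by
  obtain ⟨i, hi, h⟩ := h
  exact ⟨i, hi, h.symm⟩

theorem OnWalk.adj {u v : V} {p : G.Walk u v} {a b : V} (h : OnWalk p a b) : G.Adj a b := by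
  obtain ⟨i, hi, ⟨rfl, rfl⟩ | ⟨rfl, rfl⟩⟩ := h
  · exact p.adj_getVert_succ hi
  · exact (p.adj_getVert_succ hi).symm

theorem onWalk_of_walkChainZ2_ne_zero {u v : V} {p : G.Walk u v} {a b : V}
    (h : walkChainZ2 p a b ≠ 0) : OnWalk p a b := by
  by_contra hn
  have h₁ : traversals p a b = 0 :=
    not_not.1 fun h => hn (onWalk_of_traversals_ne_zero h)
  have h₂ : traversals p b a = 0 :=
    not_not.1 fun h => hn (onWalk_of_traversals_ne_zero h).symm
  simp [walkChainZ2, h₁, h₂] at h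

theorem isChain1Z2_walkChainZ2 {u v : V} (p : G.Walk u v) : IsChain1Z2 G (walkChainZ2 p) :=
  ⟨fun _ _ => add_comm _ _, fun _ _ h => (onWalk_of_walkChainZ2_ne_zero h).adj⟩

theorem walkChainZ2_mem_Zsuf1Z2 (c : Circuit G) : walkChainZ2 c.2 ∈ Zsuf1Z2 G := by
  obtain ⟨x, p⟩ := c
  refine ⟨isChain1Z2_walkChainZ2 p, fun v => ?_⟩
  let N : Finset V := (Finset.range (p.length + 1)).image p.getVert
  have hN : ∀ i ≤ p.length, p.getVert i ∈ N := fun i hi =>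
    Finset.mem_image_of_mem _ (Finset.mem_range.2 (by omega))
  have hsupp : Function.support (fun u => walkChainZ2 p u v) ⊆ N := by
    intro u hu
    obtain ⟨i, hi, ⟨rfl, -⟩ | ⟨-, rfl⟩⟩ := onWalk_of_walkChainZ2_ne_zero hu
    · exact hN _ hi.le
    · exact hN _ hi
  have hin : ∑ u ∈ N, traversals p u v
      = ∑ i ∈ Finset.range p.length, if p.getVert (i + 1) = v then 1 else 0 := by
    simp only [traversals, Finset.card_filter]
    rw [Finset.sum_comm]
    refine Finset.sum_congr rfl fun i hi => ?_
    have := hN i (Finset.mem_range.1 hi).le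
    by_cases h : p.getVert (i + 1) = v <;> simp [h, this]
  have hout : ∑ u ∈ N, traversals p v u
      = ∑ i ∈ Finset.range p.length, if p.getVert i = v then 1 else 0 := by
    simp only [traversals, Finset.card_filter]
    rw [Finset.sum_comm]
    refine Finset.sum_congr rfl fun i hi => ?_
    have := hN (i + 1) (Finset.mem_range.1 hi)
    by_cases h : p.getVert i = v <;> simp [h, this]
  have hshift : (∑ i ∈ Finset.range p.length, if p.getVert (i + 1) = v then 1 else 0)
      = ∑ i ∈ Finset.range p.length, if p.getVert i = v then 1 else 0 := by
    have h := Finset.sum_range_succ (fun i => if p.getVert i = v then 1 else 0) p.length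
    rw [Finset.sum_range_succ'] at h
    simpa using h
  rw [chainDivZ2, finsum_eq_sum_of_support_subset _ hsupp]
  simp only [walkChainZ2]
  rw [Finset.sum_add_distrib, ← Nat.cast_sum, ← Nat.cast_sum, hin, hout, hshift,
    CharTwo.add_self_eq_zero]

/-- In a locally finite graph there are finitely many walks of given length from a vertex. -/
theorem finite_walks_of_length (hG : ∀ v, (G.neighborSet v).Finite) (n : ℕ) (v : V) :
    {p : Σ w, G.Walk v w | p.2.length = n}.Finite := by
  induction n generalizing v with
  | zero =>
    refine (Set.finite_singleton (⟨v, .nil⟩ : Σ w, G.Walk v w)).subset ?_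
    rintro ⟨w, p⟩ hp
    cases p with
    | nil => rfl
    | cons h q => simp at hp
  | succ n ih =>
    have := (hG v).to_subtype
    refine (Set.finite_iUnion fun u : G.neighborSet v =>
      (ih u).image fun q : Σ w, G.Walk u w => (⟨q.1, .cons u.2 q.2⟩ : Σ w, G.Walk v w)).subset ?_
    rintro ⟨w, p⟩ hp
    cases p with
    | nil => simp at hp
    | cons h q => exact Set.mem_iUnion.2 ⟨⟨_, h⟩, ⟨w, q⟩, by simpa using hp, rfl⟩

theorem finite_circuits_onWalk (hG : ∀ v, (G.neighborSet v).Finite) (R : ℕ) (a b : V) :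
    {c : Circuit G | c.2.length ≤ R ∧ OnWalk c.2 a b}.Finite := by
  have hwalks (u : V) : {p : Σ w, G.Walk u w | p.2.length ≤ R}.Finite := by
    refine ((Set.finite_Iic R).biUnion fun n _ => finite_walks_of_length hG n u).subset ?_
    intro p hp
    exact Set.mem_biUnion (x := p.2.length) hp rfl
  let glue : (Σ w, G.Walk a w) × (Σ w, G.Walk a w) → Σ x, Σ y, G.Walk x y :=
    fun q => ⟨q.1.1, q.2.1, q.1.2.reverse.append q.2.2⟩
  have hinj : Function.Injective
      (fun c : Circuit G => (⟨c.1, c.1, c.2⟩ : Σ x, Σ y, G.Walk x y)) := by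
    rintro ⟨x, p⟩ ⟨y, q⟩ h
    simp only [Sigma.mk.injEq] at h
    obtain ⟨rfl, h⟩ := h
    simpa using h
  refine ((((hwalks a).prod (hwalks a)).image glue).preimage hinj.injOn).subset ?_
  rintro ⟨x, p⟩ ⟨hp, hab⟩
  obtain ⟨i, rfl⟩ : ∃ i, p.getVert i = a := by
    obtain ⟨i, -, ⟨h, -⟩ | ⟨-, h⟩⟩ := hab
    · exact ⟨i, h⟩
    · exact ⟨i + 1, h⟩
  refine ⟨(⟨x, (p.take i).reverse⟩, ⟨x, p.drop i⟩), ⟨?_, ?_⟩, ?_⟩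
  · simp at hp ⊢; omega
  · simp at hp ⊢; omega
  · simp [glue]

end Walks

section CircuitSums

variable {G : SimpleGraph V}

theorem thinCoefZ2_of_length_le (hG : ∀ v, (G.neighborSet v).Finite) {R : ℕ}
    {g : Circuit G → ZMod 2} (hg : ∀ c, g c ≠ 0 → c.2.length ≤ R) : ThinCoefZ2 G g :=
  fun a b => (finite_circuits_onWalk hG R a b).subset fun c hc => ⟨hg c hc.1, hc.2⟩

/-- The linear map sending coefficients on circuits to the sum of the circuits of length `≤ R`. -/
noncomputable def shortCircuitSum (hG : ∀ v, (G.neighborSet v).Finite) (R : ℕ) :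
    (Circuit G → ZMod 2) →ₗ[ZMod 2] (V → V → ZMod 2) where
  toFun g a b := ∑ c ∈ (finite_circuits_onWalk hG R a b).toFinset, g c * walkChainZ2 c.2 a b
  map_add' g h := by
    ext a b
    simp [add_mul, Finset.sum_add_distrib]
  map_smul' r g := by
    ext a b
    simp [Finset.mul_sum, mul_assoc]

theorem circSumZ2_eq_shortCircuitSum (hG : ∀ v, (G.neighborSet v).Finite) {R : ℕ}
    {g : Circuit G → ZMod 2} (hg : ∀ c, g c ≠ 0 → c.2.length ≤ R) :
    circSumZ2 G g = shortCircuitSum hG R g := by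
  ext a b
  refine finsum_eq_sum_of_support_subset _ fun c hc => ?_
  have hc' := mul_ne_zero_iff.1 (Function.mem_support.1 hc)
  simpa using ⟨hg c hc'.1, onWalk_of_walkChainZ2_ne_zero hc'.2⟩

theorem CrZ2_eq_range_shortCircuitSum (hG : ∀ v, (G.neighborSet v).Finite) (R : ℕ) :
    CrZ2 G R = LinearMap.range (shortCircuitSum hG R) := by
  ext f
  constructor
  · rintro ⟨g, hg, -, rfl⟩
    exact ⟨g, (circSumZ2_eq_shortCircuitSum hG hg).symm⟩
  · rintro ⟨g, rfl⟩
    let g' : Circuit G → ZMod 2 := fun c => if c.2.length ≤ R then g c else 0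
    have hg' : ∀ c, g' c ≠ 0 → c.2.length ≤ R := fun c hc => by
      by_contra h
      simp [g', h] at hc
    refine ⟨g', hg', thinCoefZ2_of_length_le hG hg', ?_⟩
    rw [circSumZ2_eq_shortCircuitSum hG hg']
    ext a b
    refine Finset.sum_congr rfl fun c hc => ?_
    simp only [Set.Finite.mem_toFinset, Set.mem_ofPred_eq] at hc
    simp [g', hc.1]

theorem isClosed_range_shortCircuitSum (hG : ∀ v, (G.neighborSet v).Finite) (R : ℕ) :
    IsClosed (LinearMap.range (shortCircuitSum hG R) : Set (V → V → ZMod 2)) := by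
  have : Continuous (shortCircuitSum hG R) :=
    continuous_pi fun a => continuous_pi fun b => continuous_finsetSum _ fun c _ =>
      (continuous_of_discreteTopology (f := fun x : ZMod 2 => x * walkChainZ2 c.2 a b)).comp
        (continuous_apply c)
  rw [LinearMap.coe_range]
  exact (isCompact_range this).isClosed

theorem CrZ2_mono {R S : ℕ} (h : R ≤ S) :
    CrZ2 G R ⊆ CrZ2 G S := by
  rintro f ⟨g, hg, ht, rfl⟩
  exact ⟨g, fun c hc => (hg c hc).trans h, ht, rfl⟩

theorem walkChainZ2_mem_CrZ2 (hG : ∀ v, (G.neighborSet v).Finite) {c : Circuit G} {R : ℕ}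
    (h : c.2.length ≤ R) : walkChainZ2 c.2 ∈ CrZ2 G R := by
  have hg : ∀ d, (Pi.single c 1 : Circuit G → ZMod 2) d ≠ 0 → d.2.length ≤ R := fun d hd => by
    obtain rfl : d = c := by
      by_contra hne
      simp [hne] at hd
    exact h
  refine ⟨Pi.single c 1, hg, thinCoefZ2_of_length_le hG hg, ?_⟩
  ext a b
  rw [circSumZ2, finsum_eq_single _ c fun d hd => by simp [hd]]
  simp

theorem chainDivZ2_eq_sum (hG : ∀ v, (G.neighborSet v).Finite) {f : V → V → ZMod 2}
    (hf : ∀ u v, f u v ≠ 0 → G.Adj u v) (v : V) :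
    chainDivZ2 f v = ∑ u ∈ (hG v).toFinset, f u v :=
  finsum_eq_sum_of_support_subset _ fun u hu => by simpa using (hf u v hu).symm

/-- The space of mod-2 cycles as a subspace of the space of all functions. -/
noncomputable def cycleSpace (hG : ∀ v, (G.neighborSet v).Finite) :
    Submodule (ZMod 2) (V → V → ZMod 2) where
  carrier := {f | (∀ u v, f u v = f v u) ∧ (∀ u v, ¬ G.Adj u v → f u v = 0) ∧
    ∀ v, ∑ u ∈ (hG v).toFinset, f u v = 0}
  zero_mem' := by simp
  add_mem' := by
    rintro f g ⟨hf₁, hf₂, hf₃⟩ ⟨hg₁, hg₂, hg₃⟩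
    refine ⟨fun u v => ?_, fun u v h => ?_, fun v => ?_⟩
    · simp [hf₁ u v, hg₁ u v]
    · simp [hf₂ u v h, hg₂ u v h]
    · simp [Finset.sum_add_distrib, hf₃, hg₃]
  smul_mem' := by
    rintro r f ⟨hf₁, hf₂, hf₃⟩
    refine ⟨fun u v => ?_, fun u v h => ?_, fun v => ?_⟩
    · simp [hf₁ u v]
    · simp [hf₂ u v h]
    · simp [← Finset.mul_sum, hf₃]

theorem mem_cycleSpace_iff (hG : ∀ v, (G.neighborSet v).Finite) {f : V → V → ZMod 2} :
    f ∈ cycleSpace hG ↔ f ∈ Zsuf1Z2 G := by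
  constructor
  · rintro ⟨h₁, h₂, h₃⟩
    have h₂' : ∀ u v, f u v ≠ 0 → G.Adj u v := fun u v => not_imp_comm.1 (h₂ u v)
    exact ⟨⟨h₁, h₂'⟩, fun v => (chainDivZ2_eq_sum hG h₂' v).trans (h₃ v)⟩
  · rintro ⟨⟨h₁, h₂⟩, h₃⟩
    exact ⟨h₁, fun u v => not_imp_comm.1 (h₂ u v),
      fun v => (chainDivZ2_eq_sum hG h₂ v).symm.trans (h₃ v)⟩

theorem isClosed_cycleSpace (hG : ∀ v, (G.neighborSet v).Finite) :
    IsClosed (cycleSpace hG : Set (V → V → ZMod 2)) := by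
  have hc : ∀ u v, Continuous fun f : V → V → ZMod 2 => f u v := fun u v =>
    (continuous_apply v).comp (continuous_apply u)
  change IsClosed {f : V → V → ZMod 2 | (∀ u v, f u v = f v u) ∧ (∀ u v, ¬ G.Adj u v → f u v = 0) ∧
    ∀ v, ∑ u ∈ (hG v).toFinset, f u v = 0}
  simp only [Set.ofPred_and, Set.ofPred_forall]
  refine IsClosed.inter ?_ (IsClosed.inter ?_ ?_)
  · exact isClosed_iInter fun u => isClosed_iInter fun v => isClosed_eq (hc u v) (hc v u)
  · exact isClosed_iInter fun u => isClosed_iInter fun v => isClosed_iInter fun _ =>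
      isClosed_eq (hc u v) continuous_const
  · exact isClosed_iInter fun v =>
      isClosed_eq (continuous_finsetSum _ fun u _ => hc u v) continuous_const

/-- The cycles that are sums of circuits of length `≤ R`. -/
noncomputable def shortCycleSpace (hG : ∀ v, (G.neighborSet v).Finite) (R : ℕ) :
    Submodule (ZMod 2) (cycleSpace hG) :=
  (LinearMap.range (shortCircuitSum hG R)).comap (cycleSpace hG).subtype

theorem mem_shortCycleSpace_iff (hG : ∀ v, (G.neighborSet v).Finite) {R : ℕ}
    {f : cycleSpace hG} : f ∈ shortCycleSpace hG R ↔ (f : V → V → ZMod 2) ∈ CrZ2 G R := by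
  rw [CrZ2_eq_range_shortCircuitSum hG]
  rfl

theorem shortCycleSpace_mono (hG : ∀ v, (G.neighborSet v).Finite) :
    Monotone (shortCycleSpace hG) := fun _ _ h _ hf =>
  (mem_shortCycleSpace_iff hG).2 (CrZ2_mono h ((mem_shortCycleSpace_iff hG).1 hf))

theorem mem_iSup_shortCycleSpace_iff (hG : ∀ v, (G.neighborSet v).Finite)
    {f : cycleSpace hG} :
    f ∈ ⨆ R, shortCycleSpace hG R ↔ (f : V → V → ZMod 2) ∈ CinfZ2 G := by
  rw [Submodule.mem_iSup_of_directed _ (shortCycleSpace_mono hG).directed_le]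
  simp [CinfZ2, mem_shortCycleSpace_iff]

/-- If the sums of circuits of length `≤ R` have finite index among the cycles, then every circuit
is a sum of circuits of some fixed bounded length. -/
theorem exists_forall_circuit_mem_CrZ2 (hG : ∀ v, (G.neighborSet v).Finite) (R : ℕ)
    [Finite (cycleSpace hG ⧸ (shortCycleSpace hG R).toAddSubgroup)] :
    ∃ S, ∀ c : Circuit G, walkChainZ2 c.2 ∈ CrZ2 G S := by
  let z : Circuit G → cycleSpace hG := fun c =>
    ⟨walkChainZ2 c.2, (mem_cycleSpace_iff hG).2 (walkChainZ2_mem_Zsuf1Z2 c)⟩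
  let cls : Circuit G → cycleSpace hG ⧸ (shortCycleSpace hG R).toAddSubgroup := fun c => z c
  obtain ⟨L, hL⟩ := (Set.finite_range fun q : Set.range cls => q.2.choose.2.length).bddAbove
  refine ⟨max R L, fun c => ?_⟩
  let q : Set.range cls := ⟨cls c, c, rfl⟩
  have hd : cls q.2.choose = cls c := q.2.choose_spec
  have h₁ : z q.2.choose ∈ shortCycleSpace hG (max R L) :=
    (mem_shortCycleSpace_iff hG).2 (walkChainZ2_mem_CrZ2 hG
      ((hL (Set.mem_range_self q)).trans (le_max_right _ _)))
  have h₂ : -z q.2.choose + z c ∈ shortCycleSpace hG (max R L) :=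
    shortCycleSpace_mono hG (le_max_left R L) (QuotientAddGroup.eq.1 hd)
  have h := add_mem h₁ h₂
  rw [add_neg_cancel_left] at h
  exact (mem_shortCycleSpace_iff hG).1 h

end CircuitSums

/-- ℤ₂-large circuits imply that H^uf_1(X,ℤ₂) is infinite
dimensional. -/
theorem stmt11 (G : SimpleGraph V) (hulf : ULF G) (hconn : G.Connected)
    (hlarge : ∀ R : ℕ, ∃ c : Circuit G,
      (fun a b => walkChainZ2 c.2 a b) ∉ CrZ2 G R) :
    ∀ n : ℕ, ∃ f : Fin n → (V → V → ZMod 2), (∀ i, f i ∈ Zsuf1Z2 G) ∧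
      ∀ a : Fin n → ZMod 2, (∑ i, a i • f i) ∈ CinfZ2 G → ∀ i, a i = 0 := by
  have hG : ∀ v, (G.neighborSet v).Finite := fun v => (hulf.choose_spec v).1
  let K := ⨆ R, shortCycleSpace hG R
  have hinf : Infinite (cycleSpace hG ⧸ K) := by
    rw [← not_finite_iff_infinite]
    intro hfin
    have : CompactSpace (cycleSpace hG) :=
      isCompact_iff_compactSpace.1 (isClosed_cycleSpace hG).isCompact
    obtain ⟨R, hR⟩ := exists_finite_quotient_of_finite_quotient_iUnion (shortCycleSpace hG) K
      (fun R => (isClosed_range_shortCircuitSum hG R).preimage continuous_subtype_val)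
      (fun x hx => (Submodule.mem_iSup_of_directed _ (shortCycleSpace_mono hG).directed_le).1 hx)
    obtain ⟨S, hS⟩ := exists_forall_circuit_mem_CrZ2 hG R
    obtain ⟨c, hc⟩ := hlarge S
    exact hc (hS c)
  intro n
  obtain ⟨q, hq⟩ := exists_linearIndependent_fin_of_infinite (M := cycleSpace hG ⧸ K) n
  choose f hf using fun i => Submodule.Quotient.mk_surjective K (q i)
  refine ⟨fun i => f i, fun i => (mem_cycleSpace_iff hG).1 (f i).2, fun a ha => ?_⟩
  refine Fintype.linearIndependent_iff.1 hq a ?_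
  have hmem : ∑ i, a i • f i ∈ K := by
    rw [mem_iSup_shortCycleSpace_iff]
    simpa using ha
  have h := (Submodule.Quotient.mk_eq_zero K).2 hmem
  rw [← Submodule.mkQ_apply, map_sum] at h
  simpa only [map_smul, Submodule.mkQ_apply, hf] using h


end UFH
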